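/- Let t_1, …, t_{2s} be pairwise distinct complex numbers, A_P = diag(t_1, …, t_s), A_Z = diag(t_{s+1}, …, t_{2s}), C_P an m×s matrix, B_P, B_Z s×m matrices, C_Z an m×s matrix, and S an s×s matrix. Define Y(x) = I + C_P·(xI − A_P)^{-1}·B_P for x ∉ {t_1, …, t_s}. Assume: (i) A_P·S − S·A_Z = B_P·C_Z; (ii) S·B_Z = −B_P; (iii) for every x ∉ {t_1, …, t_{2s}}, Y(x)·(I + C_Z·(xI − A_Z)^{-1}·B_Z) = I. Then for every x ∉ {t_1, …, t_{2s}}, the complex derivative Y′(x) satisfies Y′(x)·(I + C_Z·(xI − A_Z)^{-1}·B_Z) = C_P·(xI − A_P)^{-1}·S·(xI − A_Z)^{-1}·B_Z; that is, the logarithmic derivative of Y equals C_P(xI − A_P)^{-1} S (xI − A_Z)^{-1} B_Z. -/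

import Mathlib

/-- The resolvent of a diagonal matrix away from its spectrum. -/
theorem inv_smul_one_sub_diagonal {n K : Type*} [Fintype n] [DecidableEq n] [Field K]
    {t : n → K} {x : K} (hx : ∀ i, x ≠ t i) :
    (x • (1 : Matrix n n K) - Matrix.diagonal t)⁻¹ =
      Matrix.diagonal fun i => (x - t i)⁻¹ := by
  rw [← Matrix.diagonal_one, ← Matrix.diagonal_smul, Matrix.diagonal_sub]
  refine Matrix.inv_eq_right_inv ?_
  rw [Matrix.diagonal_mul_diagonal, ← Matrix.diagonal_one]
  congr 1
  funext i
  simpa using mul_inv_cancel₀ (sub_ne_zero.mpr (hx i))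

theorem isUnit_det_smul_one_sub_diagonal {n K : Type*} [Fintype n] [DecidableEq n] [Field K]
    {t : n → K} {x : K} (hx : ∀ i, x ≠ t i) :
    IsUnit (x • (1 : Matrix n n K) - Matrix.diagonal t).det := by
  rw [← Matrix.diagonal_one, ← Matrix.diagonal_smul, Matrix.diagonal_sub, Matrix.det_diagonal]
  exact (Finset.prod_ne_zero_iff.mpr fun i _ => by simpa using sub_ne_zero.mpr (hx i)).isUnit

/-- Entrywise derivative of a realization `1 + C (x - A)⁻¹ B` with diagonal `A`. -/
theorem hasDerivAt_realization_apply {m n 𝕜 : Type*} [DecidableEq m] [Fintype n] [DecidableEq n]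
    [NontriviallyNormedField 𝕜] {t : n → 𝕜} (C : Matrix m n 𝕜) (B : Matrix n m 𝕜) {x : 𝕜}
    (hx : ∀ i, x ≠ t i) (a b : m) :
    HasDerivAt
      (fun y => (1 + C * (y • (1 : Matrix n n 𝕜) - Matrix.diagonal t)⁻¹ * B : Matrix m m 𝕜) a b)
      ((-(C * (x • (1 : Matrix n n 𝕜) - Matrix.diagonal t)⁻¹ *
        (x • (1 : Matrix n n 𝕜) - Matrix.diagonal t)⁻¹ * B) : Matrix m m 𝕜) a b) x := by
  have hsum : HasDerivAt
      (fun y => (1 : Matrix m m 𝕜) a b + ∑ i, C a i * (y - t i)⁻¹ * B i b)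
      (∑ i, C a i * (-1 / (x - t i) ^ 2) * B i b) x :=
    (HasDerivAt.fun_sum fun i _ =>
      ((((hasDerivAt_id x).sub_const (t i)).fun_inv
        (sub_ne_zero.mpr (hx i))).const_mul (C a i)).mul_const (B i b)).const_add _
  have hev : ∀ᶠ y in nhds x, ∀ i, y ≠ t i :=
    Filter.eventually_all.mpr fun i => isOpen_ne.mem_nhds (hx i)
  rw [inv_smul_one_sub_diagonal hx]
  refine (hsum.congr_of_eventuallyEq (hev.mono fun y hy => ?_)).congr_deriv ?_
  · simp only [inv_smul_one_sub_diagonal hy, Matrix.add_apply, Matrix.mul_apply (N := B),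
      Matrix.mul_diagonal]
  · simp only [Matrix.neg_apply, Matrix.mul_apply (N := B), Matrix.mul_diagonal,
      ← Finset.sum_neg_distrib]
    refine Finset.sum_congr rfl fun i _ => ?_
    have := sub_ne_zero.mpr (hx i)
    field_simp

/-- If `A S - S D = B C` and `S E = -B`, the resolvents `P` of `A` and `Q` of `D` at `x` satisfy
`P B (1 + C Q E) = -S Q E`. -/
theorem resolvent_mul_realization_of_sylvester {m n R : Type*} [Fintype m] [DecidableEq m]
    [Fintype n] [DecidableEq n] [CommRing R] {A D S : Matrix n n R} {B E : Matrix n m R}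
    {C : Matrix m n R} (hS : A * S - S * D = B * C) (hSE : S * E = -B) {x : R}
    (hA : IsUnit (x • (1 : Matrix n n R) - A).det)
    (hD : IsUnit (x • (1 : Matrix n n R) - D).det) :
    (x • (1 : Matrix n n R) - A)⁻¹ * B * (1 + C * (x • (1 : Matrix n n R) - D)⁻¹ * E) =
      -(S * (x • (1 : Matrix n n R) - D)⁻¹ * E) := by
  have hBC : B * C = S * (x • (1 : Matrix n n R) - D) - (x • (1 : Matrix n n R) - A) * S := by
    rw [← hS]
    simp only [mul_sub, sub_mul, Matrix.mul_smul, Matrix.smul_mul, mul_one, one_mul]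
    abel
  set X := x • (1 : Matrix n n R) - A
  set W := x • (1 : Matrix n n R) - D
  calc X⁻¹ * B * (1 + C * W⁻¹ * E) = X⁻¹ * B + X⁻¹ * (B * C) * W⁻¹ * E := by
        simp only [Matrix.mul_add, Matrix.mul_one, Matrix.mul_assoc]
    _ = X⁻¹ * B + (X⁻¹ * (S * (W * W⁻¹) * E) - X⁻¹ * X * S * W⁻¹ * E) := by
        rw [hBC]
        simp only [Matrix.mul_sub, Matrix.sub_mul, Matrix.mul_assoc]
    _ = -(S * W⁻¹ * E) := by
        rw [Matrix.mul_nonsing_inv _ hD, Matrix.nonsing_inv_mul _ hA, Matrix.mul_one, hSE,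
          Matrix.mul_neg, Matrix.one_mul]
        abel


/-- The logarithmic derivative of a rational matrix function in general
position, `Y(x) = I + C_P (xI − A_P)⁻¹ B_P`, with inverse `I + C_Z (xI − A_Z)⁻¹ B_Z` and
pole-zero core matrix `S` (`A_P S − S A_Z = B_P C_Z`, `S B_Z = −B_P`), equals
`C_P (xI − A_P)⁻¹ S (xI − A_Z)⁻¹ B_Z`. -/
theorem log_derivative_of_rational (m s : ℕ) (hm : 0 < m) (hs : 0 < s)
    (tP tZ : Fin s → ℂ) (htP : Function.Injective tP) (htZ : Function.Injective tZ)
    (htPZ : ∀ α β, tP α ≠ tZ β)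
    (CP CZ : Matrix (Fin m) (Fin s) ℂ) (BP BZ : Matrix (Fin s) (Fin m) ℂ)
    (S : Matrix (Fin s) (Fin s) ℂ)
    (hS : Matrix.diagonal tP * S - S * Matrix.diagonal tZ = BP * CZ)
    (hSB : S * BZ = -BP)
    (hYZ : ∀ x : ℂ, (∀ α, x ≠ tP α) → (∀ α, x ≠ tZ α) →
      (1 + CP * (x • (1 : Matrix (Fin s) (Fin s) ℂ) - Matrix.diagonal tP)⁻¹ * BP) *
      (1 + CZ * (x • (1 : Matrix (Fin s) (Fin s) ℂ) - Matrix.diagonal tZ)⁻¹ * BZ) = 1) :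
    ∀ x : ℂ, (∀ α, x ≠ tP α) → (∀ α, x ≠ tZ α) →
      (Matrix.of fun a b => deriv
          (fun y => (1 + CP * (y • (1 : Matrix (Fin s) (Fin s) ℂ) - Matrix.diagonal tP)⁻¹ * BP
            : Matrix (Fin m) (Fin m) ℂ) a b) x) *
        (1 + CZ * (x • (1 : Matrix (Fin s) (Fin s) ℂ) - Matrix.diagonal tZ)⁻¹ * BZ) =
      CP * (x • (1 : Matrix (Fin s) (Fin s) ℂ) - Matrix.diagonal tP)⁻¹ * S *
        (x • (1 : Matrix (Fin s) (Fin s) ℂ) - Matrix.diagonal tZ)⁻¹ * BZ := by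
  intro x hP hZ
  have hderiv : (Matrix.of fun a b => deriv
      (fun y => (1 + CP * (y • (1 : Matrix (Fin s) (Fin s) ℂ) - Matrix.diagonal tP)⁻¹ * BP
        : Matrix (Fin m) (Fin m) ℂ) a b) x) =
      -(CP * (x • (1 : Matrix (Fin s) (Fin s) ℂ) - Matrix.diagonal tP)⁻¹ *
        (x • (1 : Matrix (Fin s) (Fin s) ℂ) - Matrix.diagonal tP)⁻¹ * BP) :=
    Matrix.ext fun a b => (hasDerivAt_realization_apply CP BP hP a b).deriv
  rw [hderiv, Matrix.neg_mul, Matrix.mul_assoc (CP * _), Matrix.mul_assoc (CP * _),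
    resolvent_mul_realization_of_sylvester hS hSB
      (isUnit_det_smul_one_sub_diagonal hP) (isUnit_det_smul_one_sub_diagonal hZ),
    Matrix.mul_neg, neg_neg]
  simp only [Matrix.mul_assoc]
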